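/- Let K be a Markov kernel on Polish space (X,d) with invariant distribution π, with τ(K) < ∞, and suppose E_p(x₀) < ∞ for some x₀ and p ≥ 1. Then K maps the Banach space L₀ of centred measurable Lipschitz functions into itself, defines a bounded linear operator, and its operator norm equals τ(K): ‖K‖_{L₀→L₀} = τ(K). -/

import Mathlib

open MeasureTheory ProbabilityTheory ENNReal Filter

noncomputable section

/-- `η` is a coupling of `μ` and `ν`. -/
def IsCoupling {X : Type*} [MeasurableSpace X] (η : Measure (X × X)) (μ ν : Measure X) : Prop :=
  η.map Prod.fst = μ ∧ η.map Prod.snd = ν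

/-- The 1-Wasserstein distance between two measures, w.r.t. the metric of `X`. -/
def wass {X : Type*} [MeasurableSpace X] [MetricSpace X] (μ ν : Measure X) : ℝ≥0∞ :=
  ⨅ η : {η : Measure (X × X) // IsCoupling η μ ν}, ∫⁻ p, edist p.1 p.2 ∂(η : Measure (X × X))

/-- The Kantorovich norm of a Markov kernel. -/
def tau {X : Type*} [MeasurableSpace X] [MetricSpace X] (K : Kernel X X) : ℝ≥0∞ :=
  ⨆ (x : X) (y : X) (_ : x ≠ y), wass (K x) (K y) / edist x y

/-- The `p`-eccentricity of `π` at `x₀`. -/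
def ecc {X : Type*} [MeasurableSpace X] [MetricSpace X] (π : Measure X) (p : ℝ) (x₀ : X) : ℝ≥0∞ :=
  ∫⁻ y, edist x₀ y ^ p ∂π

/-- The Lipschitz seminorm `‖f‖_d` (valued in `ℝ≥0∞`). -/
def elip {X : Type*} [MetricSpace X] (f : X → ℝ) : ℝ≥0∞ :=
  ⨆ (x : X) (y : X) (_ : x ≠ y), ENNReal.ofReal |f x - f y| / edist x y

/-- Membership in the Banach space `L₀` of centred measurable Lipschitz functions. -/
def MemL0 {X : Type*} [MeasurableSpace X] [MetricSpace X] (π : Measure X) (f : X → ℝ) : Prop :=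
  Measurable f ∧ (∃ L : ℝ, ∀ x y, |f x - f y| ≤ L * dist x y) ∧
    Integrable f π ∧ ∫ x, f x ∂π = 0

/-- A finite-dimensional form of Kantorovich–Rubinstein duality: if the weights `a` and `b` on the
points `s i` are such that every `1`-Lipschitz function has integrals differing by at most `D`, then
there is a transport plan from `a` to `b` of cost at most `D`. -/
theorem exists_transport_plan_of_forall_lipschitz {X ι : Type*} [MetricSpace X] [Fintype ι]
    (s : ι → X) (a b : ι → ℝ) (ha : ∀ i, 0 ≤ a i) (hb : ∀ i, 0 ≤ b i)
    (ha1 : ∑ i, a i = 1) (hb1 : ∑ i, b i = 1) (D : ℝ)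
    (hD : ∀ f : X → ℝ, LipschitzWith 1 f → ∑ i, a i * f (s i) - ∑ i, b i * f (s i) ≤ D) :
    ∃ w : ι → ι → ℝ, (∀ i j, 0 ≤ w i j) ∧ (∀ i, ∑ j, w i j = a i) ∧ (∀ j, ∑ i, w i j = b j) ∧
      ∑ i, ∑ j, w i j * dist (s i) (s j) ≤ D := by
  classical
  by_contra! hcon
  have hne : Nonempty ι := by
    by_contra h
    rw [not_nonempty_iff] at h
    simp at ha1
  let Φ : (ι × ι → ℝ) →ₗ[ℝ] (ι → ℝ) × (ι → ℝ) × ℝ :=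
    { toFun := fun w => (fun i => ∑ j, w (i, j), fun j => ∑ i, w (i, j),
        ∑ i, ∑ j, w (i, j) * dist (s i) (s j))
      map_add' := fun w w' => by
        ext <;> simp [Finset.sum_add_distrib, add_mul]
      map_smul' := fun c w => by
        ext <;> simp [Finset.mul_sum, mul_assoc] }
  have hdisj : Disjoint (Φ '' stdSimplex ℝ (ι × ι)) ({a} ×ˢ {b} ×ˢ Set.Iic D) := by
    rw [Set.disjoint_left]
    rintro _ ⟨w, hw, rfl⟩ ⟨h1, h2, h3⟩
    exact absurd h3 (not_le.2 (hcon (fun i j => w (i, j)) (fun i j => hw.1 _)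
      (fun i => congrFun h1 i) (fun j => congrFun h2 j)))
  obtain ⟨l, u, v, hlu, huv, hlv⟩ := geometric_hahn_banach_compact_closed
    ((convex_stdSimplex ℝ (ι × ι)).linear_image Φ)
    ((isCompact_stdSimplex ℝ (ι × ι)).image Φ.continuous_of_finiteDimensional)
    ((convex_singleton a).prod ((convex_singleton b).prod (convex_Iic D)))
    (isClosed_singleton.prod (isClosed_singleton.prod isClosed_Iic)) hdisj
  let φ : ι → ℝ := fun i => l (Pi.single i 1, 0, 0)
  let ψ : ι → ℝ := fun i => l (0, Pi.single i 1, 0)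
  let c : ℝ := l (0, 0, 1)
  have hl : ∀ (x y : ι → ℝ) (t : ℝ), l (x, y, t) = ∑ i, x i * φ i + ∑ i, y i * ψ i + t * c := by
    intro x y t
    have h1 : (x, y, t) = ∑ i, x i • ((Pi.single i 1, 0, 0) : (ι → ℝ) × (ι → ℝ) × ℝ)
        + ∑ i, y i • ((0, Pi.single i 1, 0) : (ι → ℝ) × (ι → ℝ) × ℝ)
        + t • ((0, 0, 1) : (ι → ℝ) × (ι → ℝ) × ℝ) := by
      refine Prod.ext ?_ (Prod.ext ?_ ?_)
      · ext k; simp [Prod.fst_sum, Finset.sum_apply, Pi.single_apply]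
      · ext k; simp [Prod.fst_sum, Prod.snd_sum, Finset.sum_apply, Pi.single_apply]
      · simp [Prod.snd_sum]
    rw [h1]
    simp only [map_add, map_sum, map_smul, smul_eq_mul]
    rfl
  have hpt : ∀ i j, φ i + ψ j + dist (s i) (s j) * c < u := by
    intro i j
    have := hlu _ ⟨Pi.single (i, j) 1, single_mem_stdSimplex ℝ (i, j), rfl⟩
    refine lt_of_eq_of_lt ?_ this
    have h2 : Φ (Pi.single (i, j) 1) = (Pi.single i 1, Pi.single j 1, dist (s i) (s j)) := by
      refine Prod.ext ?_ (Prod.ext ?_ ?_)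
      · ext k
        simp only [Φ, LinearMap.coe_mk, AddHom.coe_mk, Pi.single_apply, Prod.mk.injEq]
        rw [Finset.sum_eq_single j (by intro k' _ hk; simp [hk]) (by simp)]
        simp
      · ext k
        simp only [Φ, LinearMap.coe_mk, AddHom.coe_mk, Pi.single_apply, Prod.mk.injEq]
        rw [Finset.sum_eq_single i (by intro k' _ hk; simp [hk]) (by simp)]
        simp
      · simp only [Φ, LinearMap.coe_mk, AddHom.coe_mk, Pi.single_apply, Prod.mk.injEq]
        rw [Finset.sum_eq_single i (by intro k _ hk; simp [hk]) (by simp),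
          Finset.sum_eq_single j (by intro k _ hk; simp [hk]) (by simp)]
        simp
    rw [h2, hl]
    simp [Pi.single_apply]
  have hval : ∀ t ≤ D, v < ∑ i, a i * φ i + ∑ i, b i * ψ i + t * c := by
    intro t ht
    rw [← hl]
    exact hlv _ ⟨rfl, rfl, ht⟩
  have hprod : ∑ i, a i * φ i + ∑ i, b i * ψ i
      + (∑ i, ∑ j, a i * b j * dist (s i) (s j)) * c < u := by
    have hmem : (fun p : ι × ι => a p.1 * b p.2) ∈ stdSimplex ℝ (ι × ι) :=
      ⟨fun p => mul_nonneg (ha _) (hb _), by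
        rw [Fintype.sum_prod_type]
        simp [← Finset.mul_sum, ha1, hb1]⟩
    have := hlu _ ⟨_, hmem, rfl⟩
    rw [← hl]
    refine lt_of_eq_of_lt ?_ this
    congr 1
    refine Prod.ext ?_ (Prod.ext ?_ ?_)
    · ext k; simp [Φ, ← Finset.mul_sum, hb1]
    · ext k; simp [Φ, ← Finset.sum_mul, ha1]
    · simp [Φ]
  have hc : c < 0 := by
    by_contra! hc0
    have h := hval (min D (∑ i, ∑ j, a i * b j * dist (s i) (s j))) (min_le_left _ _)
    have := mul_le_mul_of_nonneg_right
      (min_le_right D (∑ i, ∑ j, a i * b j * dist (s i) (s j))) hc0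
    linarith
  let κ := -c
  have hκ : 0 < κ := neg_pos.2 hc
  let f : X → ℝ := fun x => Finset.univ.inf' Finset.univ_nonempty
    fun j => dist x (s j) - ψ j / κ
  have hf : LipschitzWith 1 f := by
    refine LipschitzWith.of_le_add fun x y => ?_
    rw [← sub_le_iff_le_add]
    refine Finset.le_inf' _ _ fun j _ => ?_
    have h1 : f x ≤ dist x (s j) - ψ j / κ := Finset.inf'_le _ (Finset.mem_univ j)
    have := dist_triangle x y (s j)
    linarith
  have hfa : ∀ i, (φ i - u) / κ ≤ f (s i) := fun i => Finset.le_inf' _ _ fun j _ => by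
    rw [div_le_iff₀ hκ, sub_mul, div_mul_cancel₀ _ hκ.ne']
    have := hpt i j
    simp only [κ]
    linarith
  have hfb : ∀ i, f (s i) ≤ - ψ i / κ := fun i => by
    have h1 : f (s i) ≤ dist (s i) (s i) - ψ i / κ := Finset.inf'_le _ (Finset.mem_univ i)
    rw [dist_self] at h1
    rw [neg_div]
    linarith
  have h1 : (∑ i, a i * φ i - u) / κ ≤ ∑ i, a i * f (s i) := by
    calc (∑ i, a i * φ i - u) / κ = ∑ i, a i * ((φ i - u) / κ) := by
          simp_rw [← mul_div_assoc, ← Finset.sum_div, mul_sub, Finset.sum_sub_distrib,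
            ← Finset.sum_mul, ha1, one_mul]
      _ ≤ _ := Finset.sum_le_sum fun i _ => mul_le_mul_of_nonneg_left (hfa i) (ha i)
  have h2 : ∑ i, b i * f (s i) ≤ - (∑ i, b i * ψ i) / κ := by
    calc _ ≤ ∑ i, b i * (- ψ i / κ) :=
          Finset.sum_le_sum fun i _ => mul_le_mul_of_nonneg_left (hfb i) (hb i)
      _ = _ := by
          simp_rw [← mul_div_assoc, ← Finset.sum_div, mul_neg, Finset.sum_neg_distrib]
  have h3 := hD f hf
  have h4 : (∑ i, a i * φ i - u) / κ - - (∑ i, b i * ψ i) / κ ≤ D := by linarith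
  rw [← sub_div, div_le_iff₀ hκ] at h4
  have h5 := hval D le_rfl
  simp only [κ] at h4
  linarith

/-- A transport plan between the masses that `μ` and `ν` give to the fibres of `T` lifts to a
coupling of `μ` and `ν`. -/
theorem exists_isCoupling_of_fiber_weights {X ι : Type*} [MeasurableSpace X] [MetricSpace X]
    [SecondCountableTopology X] [BorelSpace X] [Fintype ι]
    (μ ν : Measure X) [IsProbabilityMeasure μ] [IsProbabilityMeasure ν]
    (T : X → ι) (hT : ∀ i, MeasurableSet (T ⁻¹' {i})) (s : ι → X)
    (w : ι → ι → ℝ≥0∞) (hr : ∀ i, ∑ j, w i j = μ (T ⁻¹' {i}))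
    (hc : ∀ j, ∑ i, w i j = ν (T ⁻¹' {j})) :
    ∃ η, IsCoupling η μ ν ∧ ∫⁻ p, edist p.1 p.2 ∂η ≤
      ∫⁻ x, edist x (s (T x)) ∂μ + ∑ i, ∑ j, w i j * edist (s i) (s j)
        + ∫⁻ y, edist (s (T y)) y ∂ν := by
  classical
  let _ : MeasurableSpace ι := ⊤
  have hTm : Measurable T := measurable_to_countable' hT
  have hsT : Measurable fun x => s (T x) := measurable_from_top.comp hTm
  have hwr : ∀ i j, w i j ≤ μ (T ⁻¹' {i}) := fun i j => by
    rw [← hr]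
    exact Finset.single_le_sum (f := fun j => w i j) (fun _ _ => zero_le) (Finset.mem_univ j)
  have hwc : ∀ i j, w i j ≤ ν (T ⁻¹' {j}) := fun i j => by
    rw [← hc]
    exact Finset.single_le_sum (f := fun i => w i j) (fun _ _ => zero_le) (Finset.mem_univ i)
  have hdm : ∀ i j, w i j / (μ (T ⁻¹' {i}) * ν (T ⁻¹' {j}))
      * (μ (T ⁻¹' {i}) * ν (T ⁻¹' {j})) = w i j := by
    intro i j
    by_cases h : μ (T ⁻¹' {i}) * ν (T ⁻¹' {j}) = 0
    · rw [h, mul_zero]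
      rcases mul_eq_zero.1 h with h | h
      · exact (le_antisymm (h ▸ hwr i j) zero_le).symm
      · exact (le_antisymm (h ▸ hwc i j) zero_le).symm
    · exact ENNReal.div_mul_cancel h (ENNReal.mul_ne_top (measure_ne_top _ _) (measure_ne_top _ _))
  let η : Measure (X × X) := ∑ i, ∑ j, (w i j / (μ (T ⁻¹' {i}) * ν (T ⁻¹' {j}))) •
    (μ.restrict (T ⁻¹' {i})).prod (ν.restrict (T ⁻¹' {j}))
  have hη : ∀ {S : Set (X × X)}, η S = ∑ i, ∑ j, w i j / (μ (T ⁻¹' {i}) * ν (T ⁻¹' {j})) *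
      (μ.restrict (T ⁻¹' {i})).prod (ν.restrict (T ⁻¹' {j})) S := by
    intro S
    simp [η, Measure.finsetSum_apply]
  have hsum : ∀ (ρ : Measure X) {A : Set X}, MeasurableSet A →
      ∑ i, ρ (A ∩ T ⁻¹' {i}) = ρ A := by
    intro ρ A hA
    rw [← measure_biUnion_finset]
    · congr 1; ext x; simp
    · intro i _ j _ hij
      refine Set.disjoint_left.2 fun x hx hx' => hij ?_
      exact hx.2.symm.trans hx'.2
    · exact fun i _ => hA.inter (hT i)
  have hcanc : ∀ (ρ : Measure X) [IsProbabilityMeasure ρ] (A : Set X) (i : ι),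
      ρ (T ⁻¹' {i}) / ρ (T ⁻¹' {i}) * ρ (A ∩ T ⁻¹' {i}) = ρ (A ∩ T ⁻¹' {i}) := by
    intro ρ _ A i
    by_cases h : ρ (T ⁻¹' {i}) = 0
    · rw [measure_mono_null Set.inter_subset_right h, mul_zero]
    · rw [ENNReal.div_self h (measure_ne_top _ _), one_mul]
  have hfst : η.map Prod.fst = μ := by
    ext A hA
    rw [Measure.map_apply measurable_fst hA, hη, ← hsum μ hA]
    refine Finset.sum_congr rfl fun i _ => ?_
    rw [← hcanc, ← hr i, ENNReal.div_eq_inv_mul, Finset.mul_sum, Finset.sum_mul, hr i]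
    refine Finset.sum_congr rfl fun j _ => ?_
    rw [← Set.prod_univ, Measure.prod_prod, Measure.restrict_apply hA, Measure.restrict_apply_univ]
    by_cases h : ν (T ⁻¹' {j}) = 0
    · have : w i j = 0 := le_antisymm (h ▸ hwc i j) zero_le
      simp [this]
    · rw [ENNReal.div_eq_inv_mul,
        ENNReal.mul_inv (.inr (measure_ne_top _ _)) (.inl (measure_ne_top _ _))]
      calc _ = ((ν (T ⁻¹' {j}))⁻¹ * ν (T ⁻¹' {j})) *
            ((μ (T ⁻¹' {i}))⁻¹ * w i j * μ (A ∩ T ⁻¹' {i})) := by ring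
        _ = _ := by rw [ENNReal.inv_mul_cancel h (measure_ne_top _ _), one_mul]
  have hsnd : η.map Prod.snd = ν := by
    ext A hA
    rw [Measure.map_apply measurable_snd hA, hη, ← hsum ν hA, Finset.sum_comm]
    refine Finset.sum_congr rfl fun j _ => ?_
    rw [← hcanc, ← hc j, ENNReal.div_eq_inv_mul, Finset.mul_sum, Finset.sum_mul, hc j]
    refine Finset.sum_congr rfl fun i _ => ?_
    rw [← Set.univ_prod, Measure.prod_prod, Measure.restrict_apply hA, Measure.restrict_apply_univ]
    by_cases h : μ (T ⁻¹' {i}) = 0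
    · have : w i j = 0 := le_antisymm (h ▸ hwr i j) zero_le
      simp [this]
    · rw [ENNReal.div_eq_inv_mul,
        ENNReal.mul_inv (.inr (measure_ne_top _ _)) (.inl (measure_ne_top _ _))]
      calc _ = ((μ (T ⁻¹' {i}))⁻¹ * μ (T ⁻¹' {i})) *
            ((ν (T ⁻¹' {j}))⁻¹ * w i j * ν (A ∩ T ⁻¹' {j})) := by ring
        _ = _ := by rw [ENNReal.inv_mul_cancel h (measure_ne_top _ _), one_mul]
  have hmid : ∫⁻ p, edist (s (T p.1)) (s (T p.2)) ∂η = ∑ i, ∑ j, w i j * edist (s i) (s j) := by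
    simp only [η, lintegral_finsetSum_measure, lintegral_smul_measure, smul_eq_mul]
    refine Finset.sum_congr rfl fun i _ => Finset.sum_congr rfl fun j _ => ?_
    rw [Measure.prod_restrict]
    have : ∫⁻ p in (T ⁻¹' {i}) ×ˢ (T ⁻¹' {j}), edist (s (T p.1)) (s (T p.2)) ∂(μ.prod ν)
        = ∫⁻ p in (T ⁻¹' {i}) ×ˢ (T ⁻¹' {j}), edist (s i) (s j) ∂(μ.prod ν) := by
      refine setLIntegral_congr_fun ((hT i).prod (hT j)) fun p hp => ?_
      have h1 : T p.1 = i := hp.1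
      have h2 : T p.2 = j := hp.2
      simp only [h1, h2]
    rw [this, setLIntegral_const, Measure.prod_prod, mul_comm (edist _ _), ← mul_assoc, hdm]
  refine ⟨η, ⟨hfst, hsnd⟩, ?_⟩
  have e1 : Measurable fun x => edist x (s (T x)) := measurable_id.edist hsT
  have e2 : Measurable fun x => edist (s (T x)) x := hsT.edist measurable_id
  have e3 : Measurable fun p : X × X => edist (s (T p.1)) (s (T p.2)) :=
    (hsT.comp measurable_fst).edist (hsT.comp measurable_snd)
  have hb1 : ∫⁻ x, edist x (s (T x)) ∂μ = ∫⁻ p, edist p.1 (s (T p.1)) ∂η := by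
    rw [← lintegral_map e1 measurable_fst, hfst]
  have hb2 : ∫⁻ x, edist (s (T x)) x ∂ν = ∫⁻ p, edist (s (T p.2)) p.2 ∂η := by
    rw [← lintegral_map e2 measurable_snd, hsnd]
  have e4 : Measurable fun p : X × X => edist (s (T p.2)) p.2 := e2.comp measurable_snd
  rw [← hmid, hb1, hb2, ← lintegral_add_right _ e3, ← lintegral_add_right _ e4]
  exact lintegral_mono fun p => edist_triangle4 _ _ _ _

/-- A function with a linear bound on its oscillation is integrable against every finite measure
with finite first moment. -/
theorem integrable_of_forall_abs_sub_le {X : Type*} [MeasurableSpace X] [MetricSpace X]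
    [SecondCountableTopology X] [BorelSpace X] {μ : Measure X} [IsFiniteMeasure μ] {x₀ : X}
    (hμ : ∫⁻ x, edist x₀ x ∂μ < ∞) {f : X → ℝ} (hf : Measurable f) {L : ℝ}
    (hL : ∀ x y, |f x - f y| ≤ L * dist x y) : Integrable f μ := by
  have hd : Integrable (fun x => dist x₀ x) μ := by
    refine ⟨(measurable_const.dist measurable_id).aestronglyMeasurable, ?_⟩
    rw [hasFiniteIntegral_iff_enorm]
    refine lt_of_eq_of_lt (lintegral_congr fun x => ?_) hμ
    rw [Real.enorm_of_nonneg dist_nonneg, edist_dist]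
  refine ((integrable_const |f x₀|).add (hd.const_mul L)).mono' hf.aestronglyMeasurable
    (.of_forall fun x => ?_)
  have h := hL x x₀
  have := abs_sub_abs_le_abs_sub (f x) (f x₀)
  rw [dist_comm] at h
  simp only [Pi.add_apply, Real.norm_eq_abs]
  linarith

/-- The nontrivial half of Kantorovich–Rubinstein duality. -/
theorem wass_le_of_forall_lipschitz {X : Type*} [MeasurableSpace X] [MetricSpace X]
    [SecondCountableTopology X] [BorelSpace X]
    (μ ν : Measure X) [IsProbabilityMeasure μ] [IsProbabilityMeasure ν] (x₀ : X)
    (hμ : ∫⁻ x, edist x₀ x ∂μ < ∞) (hν : ∫⁻ x, edist x₀ x ∂ν < ∞) (D : ℝ)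
    (hD : ∀ f : X → ℝ, LipschitzWith 1 f → ∫ x, f x ∂μ - ∫ x, f x ∂ν ≤ D) :
    wass μ ν ≤ ENNReal.ofReal D := by
  classical
  have : Nonempty X := ⟨x₀⟩
  let e : ℕ → X := fun n => Nat.casesOn n x₀ (TopologicalSpace.denseSeq X)
  have he : ∀ x, x ∈ closure (Set.range e) := fun x => by
    refine closure_mono ?_ ((TopologicalSpace.denseRange_denseSeq X) x)
    rintro _ ⟨n, rfl⟩
    exact ⟨n + 1, rfl⟩
  let P : ℕ → X → X := fun N => SimpleFunc.nearestPt e N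
  have hPm : ∀ N, Measurable (P N) := fun N => (SimpleFunc.nearestPt e N).measurable
  have hPle : ∀ N x, edist (P N x) x ≤ edist x₀ x := fun N x =>
    SimpleFunc.edist_nearestPt_le e x (Nat.zero_le N)
  have hlim : ∀ (ρ : Measure X), ∫⁻ x, edist x₀ x ∂ρ < ∞ →
      Tendsto (fun N => ∫⁻ x, edist (P N x) x ∂ρ) atTop (nhds 0) := by
    intro ρ hρ
    rw [← lintegral_zero (μ := ρ)]
    refine tendsto_lintegral_of_dominated_convergence (fun x => edist x₀ x)
      (fun N => (hPm N).edist measurable_id) (fun N => .of_forall (hPle N)) hρ.ne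
      (.of_forall fun x => ?_)
    exact tendsto_iff_edist_tendsto_0.1 (SimpleFunc.tendsto_nearestPt (he x))
  have hbound : ∀ N, wass μ ν ≤ ENNReal.ofReal D
      + 2 * (∫⁻ x, edist (P N x) x ∂μ + ∫⁻ x, edist (P N x) x ∂ν) := by
    intro N
    let T : X → Fin (N + 1) := fun x =>
      ⟨SimpleFunc.nearestPtInd e N x, Nat.lt_succ_of_le (SimpleFunc.nearestPtInd_le e N x)⟩
    let s : Fin (N + 1) → X := fun i => e i
    have hT : ∀ i, MeasurableSet (T ⁻¹' {i}) := fun i => by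
      have : T ⁻¹' {i} = SimpleFunc.nearestPtInd e N ⁻¹' {(i : ℕ)} := by
        ext x; simp [T, Fin.ext_iff]
      rw [this]
      exact SimpleFunc.measurableSet_fiber _ _
    have hPT : ∀ x, P N x = s (T x) := fun x => rfl
    have hsum : ∀ (ρ : Measure X) [IsProbabilityMeasure ρ] (f : X → ℝ),
        ∫ x, f (P N x) ∂ρ = ∑ i, ρ.real (T ⁻¹' {i}) * f (s i) := by
      intro ρ _ f
      have h1 : ∀ x, f (P N x) = ∑ i, (T ⁻¹' {i}).indicator (fun _ : X => f (s i)) x := by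
        intro x
        rw [hPT, Finset.sum_eq_single (T x)]
        · exact (Set.indicator_of_mem (s := T ⁻¹' {T x}) rfl fun _ : X => f (s (T x))).symm
        · intro i _ hi
          exact Set.indicator_of_notMem (s := T ⁻¹' {i}) (fun h : T x = i => hi h.symm)
            fun _ : X => f (s i)
        · simp
      simp_rw [h1]
      rw [integral_finsetSum _ fun i _ => (integrable_const _).indicator (hT i)]
      simp_rw [integral_indicator_const _ (hT _), smul_eq_mul]
    have hone : ∀ (ρ : Measure X) [IsProbabilityMeasure ρ], ∑ i, ρ.real (T ⁻¹' {i}) = 1 := by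
      intro ρ _
      simpa using (hsum ρ fun _ => 1).symm
    have hfin : ∀ (ρ : Measure X), ∫⁻ x, edist x₀ x ∂ρ < ∞ → ∫⁻ x, edist (P N x) x ∂ρ ≠ ∞ :=
      fun ρ hρ => ((lintegral_mono (hPle N)).trans_lt hρ).ne
    have hclose : ∀ (ρ : Measure X) [IsProbabilityMeasure ρ], ∫⁻ x, edist x₀ x ∂ρ < ∞ →
        ∀ f : X → ℝ, LipschitzWith 1 f →
        |∫ x, f (P N x) ∂ρ - ∫ x, f x ∂ρ| ≤ (∫⁻ x, edist (P N x) x ∂ρ).toReal := by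
      intro ρ _ hρ f hf
      have hfL : ∀ x y, |f x - f y| ≤ 1 * dist x y := fun x y => by
        simpa [Real.dist_eq] using hf.dist_le_mul x y
      have hfi := integrable_of_forall_abs_sub_le hρ hf.continuous.measurable hfL
      have hdi : Integrable (fun x => dist (P N x) x) ρ := by
        refine ⟨((hPm N).dist measurable_id).aestronglyMeasurable, ?_⟩
        rw [hasFiniteIntegral_iff_enorm]
        refine lt_of_eq_of_lt (lintegral_congr fun x => ?_) (hfin ρ hρ).lt_top
        rw [Real.enorm_of_nonneg dist_nonneg, edist_dist]
      have hdiff : Integrable (fun x => f (P N x) - f x) ρ :=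
        hdi.mono' ((hf.continuous.measurable.comp (hPm N)).sub
          hf.continuous.measurable).aestronglyMeasurable
          (.of_forall fun x => by simpa using hfL (P N x) x)
      have hfP : Integrable (fun x => f (P N x)) ρ := by
        refine (hdiff.add hfi).congr (.of_forall fun x => ?_)
        simp
      rw [← integral_sub hfP hfi]
      calc _ ≤ ∫ x, dist (P N x) x ∂ρ :=
            norm_integral_le_of_norm_le (f := fun x => f (P N x) - f x) hdi
              (.of_forall fun x => by simpa using hfL (P N x) x)
        _ = _ := by
            rw [integral_eq_lintegral_of_nonneg_ae (.of_forall fun x => dist_nonneg) hdi.1]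
            simp_rw [edist_dist]
    have hdisc : ∀ f : X → ℝ, LipschitzWith 1 f →
        ∑ i, μ.real (T ⁻¹' {i}) * f (s i) - ∑ i, ν.real (T ⁻¹' {i}) * f (s i) ≤
        D + ((∫⁻ x, edist (P N x) x ∂μ).toReal + (∫⁻ x, edist (P N x) x ∂ν).toReal) := by
      intro f hf
      rw [← hsum, ← hsum]
      have h1 := le_of_abs_le (hclose μ hμ f hf)
      have h2 := neg_le_of_abs_le (hclose ν hν f hf)
      have h3 := hD f hf
      linarith
    obtain ⟨w, hw0, hwr, hwc, hwD⟩ := exists_transport_plan_of_forall_lipschitz s _ _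
      (fun _ => measureReal_nonneg) (fun _ => measureReal_nonneg) (hone μ) (hone ν) _ hdisc
    obtain ⟨η, hη, hcost⟩ := exists_isCoupling_of_fiber_weights μ ν T hT s
      (fun i j => ENNReal.ofReal (w i j))
      (fun i => by
        rw [← ENNReal.ofReal_sum_of_nonneg fun j _ => hw0 i j, hwr, ofReal_measureReal])
      (fun j => by
        rw [← ENNReal.ofReal_sum_of_nonneg fun i _ => hw0 i j, hwc, ofReal_measureReal])
    have hmid : ∑ i, ∑ j, ENNReal.ofReal (w i j) * edist (s i) (s j) ≤ ENNReal.ofReal D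
        + (∫⁻ x, edist (P N x) x ∂μ + ∫⁻ x, edist (P N x) x ∂ν) := by
      calc _ = ENNReal.ofReal (∑ i, ∑ j, w i j * dist (s i) (s j)) := by
            rw [ENNReal.ofReal_sum_of_nonneg fun i _ => Finset.sum_nonneg fun j _ =>
              mul_nonneg (hw0 i j) dist_nonneg]
            refine Finset.sum_congr rfl fun i _ => ?_
            rw [ENNReal.ofReal_sum_of_nonneg fun j _ => mul_nonneg (hw0 i j) dist_nonneg]
            refine Finset.sum_congr rfl fun j _ => ?_
            rw [ENNReal.ofReal_mul (hw0 i j), edist_dist]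
        _ ≤ _ := (ENNReal.ofReal_le_ofReal hwD).trans ENNReal.ofReal_add_le
        _ ≤ _ := by
            gcongr
            refine ENNReal.ofReal_add_le.trans ?_
            rw [ENNReal.ofReal_toReal (hfin μ hμ), ENNReal.ofReal_toReal (hfin ν hν)]
    calc wass μ ν ≤ ∫⁻ p, edist p.1 p.2 ∂η :=
          iInf_le (fun η : {η : Measure (X × X) // IsCoupling η μ ν} =>
            ∫⁻ p, edist p.1 p.2 ∂(η : Measure (X × X))) ⟨η, hη⟩
      _ ≤ _ := hcost
      _ ≤ ∫⁻ x, edist (P N x) x ∂μ + (ENNReal.ofReal D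
            + (∫⁻ x, edist (P N x) x ∂μ + ∫⁻ x, edist (P N x) x ∂ν))
            + ∫⁻ x, edist (P N x) x ∂ν := by
          refine add_le_add (add_le_add (le_of_eq ?_) hmid) le_rfl
          exact lintegral_congr fun x => by rw [edist_comm, hPT]
      _ = _ := by ring
  have hlim2 : Tendsto (fun N => ENNReal.ofReal D
      + 2 * (∫⁻ x, edist (P N x) x ∂μ + ∫⁻ x, edist (P N x) x ∂ν)) atTop
      (nhds (ENNReal.ofReal D + 2 * (0 + 0))) :=
    tendsto_const_nhds.add
      (ENNReal.Tendsto.const_mul ((hlim μ hμ).add (hlim ν hν)) (.inr (by simp)))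
  simpa using ge_of_tendsto' hlim2 hbound

/-- The easy half of Kantorovich–Rubinstein duality. -/
theorem ofReal_abs_integral_sub_le_mul_wass {X : Type*} [MeasurableSpace X] [MetricSpace X]
    [SecondCountableTopology X] [BorelSpace X] {μ ν : Measure X} [IsProbabilityMeasure μ]
    [IsProbabilityMeasure ν] {f : X → ℝ}
    (hfm : Measurable f) (hμ : Integrable f μ) (hν : Integrable f ν) {L : ℝ≥0∞} (hL : L ≠ ∞)
    (hf : ∀ x y, ENNReal.ofReal |f x - f y| ≤ L * edist x y) :
    ENNReal.ofReal |∫ x, f x ∂μ - ∫ x, f x ∂ν| ≤ L * wass μ ν := by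
  have : Nonempty {η : Measure (X × X) // IsCoupling η μ ν} :=
    ⟨μ.prod ν, by simp [IsCoupling]⟩
  rw [wass, ENNReal.mul_iInf (fun h => absurd h hL)]
  refine le_iInf fun ⟨η, h1, h2⟩ => ?_
  have i1 : Integrable (fun p : X × X => f p.1) η := by
    rw [← h1] at hμ
    exact hμ.comp_measurable measurable_fst
  have i2 : Integrable (fun p : X × X => f p.2) η := by
    rw [← h2] at hν
    exact hν.comp_measurable measurable_snd
  have e1 : ∫ x, f x ∂μ = ∫ p, f p.1 ∂η := by
    rw [← h1, integral_map measurable_fst.aemeasurable hfm.aestronglyMeasurable]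
  have e2 : ∫ x, f x ∂ν = ∫ p, f p.2 ∂η := by
    rw [← h2, integral_map measurable_snd.aemeasurable hfm.aestronglyMeasurable]
  rw [e1, e2, ← integral_sub i1 i2, ← Real.norm_eq_abs, ofReal_norm,
    ← lintegral_const_mul _ measurable_edist]
  refine (enorm_integral_le_lintegral_enorm _).trans (lintegral_mono fun p => ?_)
  simpa [← ofReal_norm] using hf p.1 p.2

theorem wass_le_tau_mul_edist {X : Type*} [MeasurableSpace X] [MetricSpace X] (K : Kernel X X)
    {x y : X} (hxy : x ≠ y) : wass (K x) (K y) ≤ tau K * edist x y := by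
  rw [← ENNReal.div_le_iff (by simpa using hxy) (edist_ne_top _ _)]
  exact le_iSup₂_of_le x y (le_iSup_of_le hxy le_rfl)

theorem ofReal_abs_sub_le_elip_mul_edist {X : Type*} [MetricSpace X] (f : X → ℝ) (x y : X) :
    ENNReal.ofReal |f x - f y| ≤ elip f * edist x y := by
  rcases eq_or_ne x y with rfl | hxy
  · simp
  · rw [← ENNReal.div_le_iff (by simpa using hxy) (edist_ne_top _ _)]
    exact le_iSup₂_of_le x y (le_iSup_of_le hxy le_rfl)

theorem elip_le_of_forall {X : Type*} [MetricSpace X] {f : X → ℝ} {L : ℝ≥0∞}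
    (h : ∀ x y, x ≠ y → ENNReal.ofReal |f x - f y| ≤ L * edist x y) : elip f ≤ L :=
  iSup_le fun x => iSup_le fun y => iSup_le fun hxy => by
    rw [ENNReal.div_le_iff (by simpa using hxy) (edist_ne_top _ _)]
    exact h x y hxy

theorem lintegral_edist_lt_top_of_ecc {X : Type*} [MeasurableSpace X] [MetricSpace X]
    {π : Measure X} [IsFiniteMeasure π] {p : ℝ} (hp : 1 ≤ p) {x₀ : X} (hE : ecc π p x₀ < ∞) :
    ∫⁻ y, edist x₀ y ∂π < ∞ := by
  refine (lintegral_mono (g := fun y => 1 + edist x₀ y ^ p) fun y => ?_).trans_lt ?_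
  · rcases le_total (edist x₀ y) 1 with h | h
    · exact h.trans le_self_add
    · calc edist x₀ y = edist x₀ y ^ (1 : ℝ) := (ENNReal.rpow_one _).symm
        _ ≤ edist x₀ y ^ p := ENNReal.rpow_le_rpow_of_exponent_le h hp
        _ ≤ _ := le_add_self
  · rw [lintegral_add_left measurable_const]
    exact ENNReal.add_lt_top.2 ⟨by simp, hE⟩

/-- If `τ(K) < ∞` and the invariant distribution has finite first moment, then so does `K x` for
every `x`. -/
theorem lintegral_edist_kernel_lt_top {X : Type*} [MeasurableSpace X] [MetricSpace X]
    [SecondCountableTopology X] [BorelSpace X] {π : Measure X} [IsProbabilityMeasure π]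
    {K : Kernel X X} (hinv : π.bind K = π) (htau : tau K < ∞) {x₀ : X}
    (hπ : ∫⁻ y, edist x₀ y ∂π < ∞) (x : X) : ∫⁻ y, edist x₀ y ∂(K x) < ∞ := by
  have hm : Measurable fun y : X => edist x₀ y := measurable_edist_right
  have hb := hπ
  rw [← hinv, Measure.lintegral_bind K.aemeasurable hm.aemeasurable] at hb
  obtain ⟨z, hz⟩ := (ae_lt_top hm.lintegral_kernel hb.ne).exists
  rcases eq_or_ne x z with rfl | hxz
  · exact hz
  have hw : wass (K x) (K z) < ∞ :=
    (wass_le_tau_mul_edist K hxz).trans_lt (ENNReal.mul_lt_top htau (edist_lt_top _ _))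
  obtain ⟨⟨η, h1, h2⟩, hη⟩ := iInf_lt_iff.1 hw
  rw [← h1, lintegral_map hm measurable_fst]
  rw [← h2, lintegral_map hm measurable_snd] at hz
  refine (lintegral_mono (g := fun p : X × X => edist x₀ p.2 + edist p.1 p.2) fun p => ?_).trans_lt ?_
  · dsimp only
    rw [edist_comm p.1 p.2]
    exact edist_triangle _ _ _
  · rw [lintegral_add_right _ measurable_edist]
    exact ENNReal.add_lt_top.2 ⟨hz, hη⟩

theorem elip_lt_top_of_memL0 {X : Type*} [MeasurableSpace X] [MetricSpace X] {π : Measure X}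
    {f : X → ℝ} (hf : MemL0 π f) : elip f < ∞ := by
  obtain ⟨-, ⟨L, hL⟩, -⟩ := hf
  refine (elip_le_of_forall (L := ENNReal.ofReal L) fun x y _ => ?_).trans_lt ENNReal.ofReal_lt_top
  rw [edist_dist, ← ENNReal.ofReal_mul' dist_nonneg]
  exact ENNReal.ofReal_le_ofReal (hL x y)

/-- a kernel `K` with `τ(K) < ∞` and invariant distribution `π` maps `L₀`
into itself and its operator norm on `L₀` equals `τ(K)`. -/
theorem opNorm_eq_tau {X : Type*} [MeasurableSpace X] [MetricSpace X]
    [PolishSpace X] [BorelSpace X]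
    (π : Measure X) [IsProbabilityMeasure π]
    (K : Kernel X X) [IsMarkovKernel K] (hinv : π.bind K = π)
    (htau : tau K < ∞)
    (p : ℝ) (hp : 1 ≤ p) (x₀ : X) (hE : ecc π p x₀ < ∞) :
    (∀ f : X → ℝ, MemL0 π f → MemL0 π (fun x => ∫ y, f y ∂(K x))) ∧
      (⨆ f : {f : X → ℝ // MemL0 π f ∧ elip f ≤ 1},
        elip (fun x => ∫ y, (f : X → ℝ) y ∂(K x))) = tau K := by
  have hπ := lintegral_edist_lt_top_of_ecc hp hE
  have hK := lintegral_edist_kernel_lt_top hinv htau hπ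
  have hKint : ∀ f, MemL0 π f → ∀ x, Integrable f (K x) := fun f hf x =>
    integrable_of_forall_abs_sub_le (hK x) hf.1 hf.2.1.choose_spec
  have helip : ∀ f, MemL0 π f →
      elip (fun x => ∫ y, f y ∂(K x)) ≤ elip f * tau K := fun f hf =>
    elip_le_of_forall fun x y hxy => by
      rw [mul_assoc]
      refine (ofReal_abs_integral_sub_le_mul_wass hf.1 (hKint f hf x) (hKint f hf y)
        (elip_lt_top_of_memL0 hf).ne (ofReal_abs_sub_le_elip_mul_edist f)).trans ?_
      gcongr
      exact wass_le_tau_mul_edist K hxy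
  refine ⟨fun f hf => ⟨?_, ⟨(elip f * tau K).toReal, fun x y => ?_⟩, ?_, ?_⟩, le_antisymm ?_ ?_⟩
  · exact (hf.1.stronglyMeasurable.integral_kernel (κ := K)).measurable
  · have hfin : elip f * tau K < ∞ := ENNReal.mul_lt_top (elip_lt_top_of_memL0 hf) htau
    have h := (ofReal_abs_sub_le_elip_mul_edist (fun x => ∫ y, f y ∂(K x)) x y).trans
      (mul_le_mul_left (helip f hf) (edist x y))
    rw [edist_dist, ← ENNReal.ofReal_toReal hfin.ne, ← ENNReal.ofReal_mul toReal_nonneg] at h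
    exact (ENNReal.ofReal_le_ofReal_iff (mul_nonneg toReal_nonneg dist_nonneg)).1 h
  · have hfi := hf.2.2.1
    rw [← hinv] at hfi
    have hnorm := ((Measure.integrable_comp_iff hfi.1).1 hfi).2
    exact hnorm.mono'
      (hf.1.stronglyMeasurable.integral_kernel (κ := K)).aestronglyMeasurable
      (.of_forall fun x => norm_integral_le_integral_norm _)
  · have hfi := hf.2.2.1
    rw [← hinv] at hfi
    rw [Measure.comp_eq_comp_const_apply] at hfi
    have h := Kernel.integral_comp hfi
    rw [← Measure.comp_eq_comp_const_apply, hinv, Kernel.const_apply] at h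
    exact h.symm.trans hf.2.2.2
  · refine iSup_le fun ⟨f, hf, h1⟩ => (helip f hf).trans ?_
    exact (mul_le_mul_left h1 _).trans_eq (one_mul _)
  · set C := ⨆ f : {f : X → ℝ // MemL0 π f ∧ elip f ≤ 1},
      elip (fun x => ∫ y, (f : X → ℝ) y ∂(K x)) with hC
    have hCtau : C ≤ tau K := iSup_le fun ⟨f, hf, h1⟩ => (helip f hf).trans
      ((mul_le_mul_left h1 _).trans_eq (one_mul _))
    refine iSup_le fun x => iSup_le fun y => iSup_le fun hxy => ?_
    rw [ENNReal.div_le_iff (by simpa using hxy) (edist_ne_top _ _)]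
    have hfin : C * edist x y ≠ ∞ :=
      ENNReal.mul_ne_top (hCtau.trans_lt htau).ne (edist_ne_top _ _)
    rw [← ENNReal.ofReal_toReal hfin]
    refine wass_le_of_forall_lipschitz (K x) (K y) x₀ (hK x) (hK y) _ fun h hh => ?_
    have hhL : ∀ x y, |h x - h y| ≤ 1 * dist x y := fun x y => by
      simpa [Real.dist_eq] using hh.dist_le_mul x y
    have hhm := hh.continuous.measurable
    have hhi := integrable_of_forall_abs_sub_le hπ hhm hhL
    let f : X → ℝ := fun z => h z - ∫ u, h u ∂π
    have hf : MemL0 π f := by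
      refine ⟨hhm.sub_const _, ⟨1, fun u v => by simpa [f] using hhL u v⟩,
        hhi.sub (integrable_const _), ?_⟩
      simp only [f]
      rw [integral_sub hhi (integrable_const _)]
      simp
    have hf1 : elip f ≤ 1 := elip_le_of_forall fun u v _ => by
      rw [one_mul, edist_dist]
      exact ENNReal.ofReal_le_ofReal (by simpa [f] using hhL u v)
    have hKf : ∀ z, ∫ u, f u ∂(K z) = ∫ u, h u ∂(K z) - ∫ u, h u ∂π := fun z => by
      simp only [f]
      rw [integral_sub (integrable_of_forall_abs_sub_le (hK z) hhm hhL) (integrable_const _)]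
      simp
    have hle := (ofReal_abs_sub_le_elip_mul_edist (fun z => ∫ u, f u ∂(K z)) x y).trans
      (mul_le_mul_left (le_iSup (fun f : {f : X → ℝ // MemL0 π f ∧ elip f ≤ 1} =>
        elip (fun x => ∫ y, (f : X → ℝ) y ∂(K x))) ⟨f, hf, hf1⟩) (edist x y))
    simp only [hKf, sub_sub_sub_cancel_right] at hle
    exact (le_abs_self _).trans ((ENNReal.ofReal_le_iff_le_toReal hfin).1 hle)
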